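/- arXiv:2510.05915 — 5 statements merged into one kernel-verified Lean document; each statement's English description precedes it below -/
import Mathlib

section
/- If A is an integral domain that is a finitely generated algebra over a field K, then the Krull dimension of A equals the transcendence degree over K of the fraction field of A. -/
/-- Transcendence degree of `L` over `K`: the supremum of cardinalities of
algebraically independent subsets. -/
noncomputable def trdeg (K : Type*) (L : Type*) [CommRing K] [CommRing L] [Algebra K L] :
    Cardinal :=
  ⨆ s : {s : Set L // AlgebraicIndependent K ((↑) : s → L)}, Cardinal.mk s.1

theorem ringKrullDim_eq_of_integral_aux (R S : Type*) [CommRing R] [CommRing S] [Algebra R S]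
    [Algebra.IsIntegral R S] (hinj : Function.Injective (algebraMap R S)) :
    ringKrullDim R = ringKrullDim S := by
  apply le_antisymm
  · refine iSup_le fun l => ?_
    obtain ⟨Q, hQ, hQ'⟩ := Ideal.exists_ideal_over_prime_of_isIntegral (S := S)
      (RelSeries.head l).asIdeal ⊥ (by
        intro x hx
        have : algebraMap R S x = 0 := by simpa using hx
        rw [(map_eq_zero_iff _ hinj).1 this]
        exact Ideal.zero_mem _)
    obtain ⟨hQp, hQc⟩ := hQ'
    have : Q.LiesOver (RelSeries.head l).asIdeal := ⟨hQc.symm⟩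
    obtain ⟨L, hL, -⟩ := Ideal.exists_ltSeries_of_hasGoingUp l Q
    rw [← hL]
    exact Order.LTSeries.length_le_krullDim L
  · refine Order.krullDim_le_of_strictMono (PrimeSpectrum.comap (algebraMap R S)) ?_
    intro I J h
    exact Ideal.IsIntegral.comap_lt_comap (R := R) (I := I.asIdeal) (J := J.asIdeal) h

/-- If `A` is a domain which is a finitely generated algebra over a field `K`, then the Krull
dimension of `A` equals the transcendence degree over `K` of the fraction field of `A`. -/
theorem ringKrullDim_eq_trdeg_fractionRing
    (K A : Type) [Field K] [CommRing A] [IsDomain A] [Algebra K A]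
    [Algebra.FiniteType K A] :
    ringKrullDim A = ((Cardinal.toENat (trdeg K (FractionRing A)) : ℕ∞) : WithBot ℕ∞) := by
  have ht : trdeg K (FractionRing A) = Algebra.trdeg K (FractionRing A) := rfl
  obtain ⟨s, g, hg, hint⟩ := exists_integral_inj_algHom_of_fg K A
  let P := MvPolynomial (Fin s) K
  let : Algebra P A := g.toRingHom.toAlgebra
  have : IsScalarTower K P A := IsScalarTower.of_algebraMap_eq fun x => (g.commutes x).symm
  have : Algebra.IsIntegral P A := ⟨hint⟩
  have hinj : Function.Injective (algebraMap P A) := hg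
  have : FaithfulSMul P A := (faithfulSMul_iff_algebraMap_injective P A).2 hinj
  have : IsScalarTower K P (FractionRing A) := inferInstance
  have : FaithfulSMul P (FractionRing A) := FaithfulSMul.trans P A (FractionRing A)
  have : Algebra.IsAlgebraic A (FractionRing A) :=
    IsLocalization.isAlgebraic (FractionRing A) (nonZeroDivisors A)
  have : Algebra.IsAlgebraic P (FractionRing A) := Algebra.IsAlgebraic.trans P A (FractionRing A)
  have h1 := _root_.trdeg_add_eq K P (A := FractionRing A)
  rw [_root_.trdeg_eq_zero (R := P), add_zero, MvPolynomial.trdeg_of_isDomain] at h1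
  rw [ht, ← h1, ← ringKrullDim_eq_of_integral_aux P A hinj,
    MvPolynomial.ringKrullDim_of_isNoetherianRing, ringKrullDim_eq_zero_of_field]
  simp
end

section
/- If G is a connected finite simple graph on n ≥ 2 vertices, then n − 1 ≤ ℓ(J_G) ≤ 2n − 3, where ℓ(J_G) is the analytic spread of the binomial edge ideal of G. -/
open MvPolynomial

/-- The edge binomials of a graph, viewed inside the fraction field of
`K[x_v, y_v : v ∈ V]` (the `Sum.inl` variables are the `x`s, `Sum.inr` the `y`s). -/
noncomputable def edgeBinoms (K : Type) [Field K] {V : Type} (G : SimpleGraph V) :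
    Set (FractionRing (MvPolynomial (V ⊕ V) K)) :=
  {z | ∃ i j, G.Adj i j ∧
    z = algebraMap (MvPolynomial (V ⊕ V) K) (FractionRing (MvPolynomial (V ⊕ V) K))
      (X (Sum.inl i) * X (Sum.inr j) - X (Sum.inl j) * X (Sum.inr i))}

/-- The analytic spread of the binomial edge ideal `J_G`: the transcendence degree over `K`
of the subfield generated by the edge binomials. -/
noncomputable def spread (K : Type) [Field K] {V : Type} (G : SimpleGraph V) : Cardinal :=
  trdeg K (IntermediateField.adjoin K (edgeBinoms K G))

lemma trdeg_eq_alg (K L : Type) [CommRing K] [CommRing L] [Algebra K L] :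
    trdeg K L = Algebra.trdeg K L := rfl

open scoped IntermediateField.algebraAdjoinAdjoin in
lemma trdeg_field_adjoin_le (K E : Type) [Field K] [Field E] [Algebra K E] (T : Set E) :
    Algebra.trdeg K (IntermediateField.adjoin K T) ≤ Cardinal.mk T := by
  have halg : Algebra.IsAlgebraic (Algebra.adjoin K T) (IntermediateField.adjoin K T) :=
    IsLocalization.isAlgebraic _ (nonZeroDivisors (Algebra.adjoin K T))
  have hadd := trdeg_add_eq K (Algebra.adjoin K T) (A := IntermediateField.adjoin K T)
  rw [trdeg_eq_zero (R := Algebra.adjoin K T), add_zero] at hadd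
  rw [← hadd]
  have hr : (MvPolynomial.aeval (R := K) ((↑) : T → E)).range = Algebra.adjoin K T := by
    rw [← Algebra.adjoin_range_eq_range_aeval, Subtype.range_coe]
  rw [← hr]
  have := trdeg_le_of_surjective (MvPolynomial.aeval (R := K) ((↑) : T → E)).rangeRestrict
    (AlgHom.rangeRestrict_surjective _)
  simpa using this

lemma fractionRing_subfield_top {K σ : Type} [Field K]
    (S : Subfield (FractionRing (MvPolynomial σ K)))
    (hC : ∀ a : K, algebraMap (MvPolynomial σ K) _ (C a) ∈ S)
    (hX : ∀ i, algebraMap (MvPolynomial σ K) _ (X i) ∈ S)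
    (z : FractionRing (MvPolynomial σ K)) : z ∈ S := by
  have hp : ∀ p : MvPolynomial σ K,
      algebraMap (MvPolynomial σ K) (FractionRing (MvPolynomial σ K)) p ∈ S := by
    intro p
    induction p using MvPolynomial.induction_on with
    | C a => exact hC a
    | add p q hp hq => rw [map_add]; exact S.add_mem hp hq
    | mul_X p i hp => rw [map_mul]; exact S.mul_mem hp (hX i)
  obtain ⟨a, b, -, rfl⟩ := IsFractionRing.div_surjective (A := MvPolynomial σ K) z
  exact S.div_mem (hp a) (hp b)

section
variable (K : Type) [Field K] {V : Type}

/-- The variables `x_i` in the fraction field. -/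
noncomputable def xv (i : V) : FractionRing (MvPolynomial (V ⊕ V) K) :=
  algebraMap (MvPolynomial (V ⊕ V) K) _ (X (Sum.inl i))

/-- The variables `y_i` in the fraction field. -/
noncomputable def yv (i : V) : FractionRing (MvPolynomial (V ⊕ V) K) :=
  algebraMap (MvPolynomial (V ⊕ V) K) _ (X (Sum.inr i))

lemma mem_edgeBinoms (G : SimpleGraph V) (z) : z ∈ edgeBinoms K G ↔
    ∃ i j, G.Adj i j ∧ z = xv K i * yv K j - xv K j * yv K i := by
  simp [edgeBinoms, xv, yv]

lemma xv_ne_zero (i : V) : xv K i ≠ 0 := by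
  unfold xv
  rw [Ne, IsFractionRing.to_map_eq_zero_iff]
  exact X_ne_zero _

lemma binom_ne_zero {i j : V} (h : i ≠ j) : xv K i * yv K j - xv K j * yv K i ≠ 0 := by
  classical
  unfold xv yv
  rw [← map_mul, ← map_mul, ← map_sub, Ne, IsFractionRing.to_map_eq_zero_iff]
  intro h0
  have := congrArg (MvPolynomial.eval
    (Sum.elim (fun k => if k = i then (1:K) else 0) (fun k => if k = j then (1:K) else 0))) h0
  simp [h, h.symm] at this

end

lemma spread_upper (K : Type) [Field K] (m : ℕ) (G : SimpleGraph (Fin (m + 2))) :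
    spread K G ≤ ((2 * m + 1 : ℕ) : Cardinal) := by
  let p : Fin (m+2) → Fin (m+2) → FractionRing (MvPolynomial (Fin (m+2) ⊕ Fin (m+2)) K) :=
    fun i j => xv K i * yv K j - xv K j * yv K i
  let g : Option (Fin m ⊕ Fin m) → FractionRing (MvPolynomial (Fin (m+2) ⊕ Fin (m+2)) K) :=
    fun o => o.elim (p 0 1) (Sum.elim (fun k => p 0 k.succ.succ) (fun k => p 1 k.succ.succ))
  let M := IntermediateField.adjoin K (Set.range g)
  have hg : ∀ o, g o ∈ M := fun o => IntermediateField.subset_adjoin _ _ ⟨o, rfl⟩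
  have h01 : p 0 1 ∈ M := hg none
  have h0 : ∀ j, p 0 j ∈ M := by
    intro j
    induction j using Fin.cases with
    | zero => have : p 0 0 = 0 := sub_self _
              rw [this]; exact M.zero_mem
    | succ j =>
      induction j using Fin.cases with
      | zero => exact h01
      | succ k => exact hg (some (Sum.inl k))
  have h1 : ∀ j, p 1 j ∈ M := by
    intro j
    induction j using Fin.cases with
    | zero => have : p 1 0 = - p 0 1 := by simp only [p]; ring
              rw [this]; exact M.neg_mem h01
    | succ j =>
      induction j using Fin.cases with
      | zero => have : p 1 1 = 0 := sub_self _
                exact this ▸ M.zero_mem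
      | succ k => exact hg (some (Sum.inr k))
  have hne : p 0 1 ≠ 0 := binom_ne_zero K (by simp)
  have hp : ∀ i j, p i j ∈ M := by
    intro i j
    have : p i j = (p 0 i * p 1 j - p 0 j * p 1 i) / p 0 1 := by
      rw [eq_div_iff hne]; simp only [p]; ring
    rw [this]
    exact M.div_mem (M.sub_mem (M.mul_mem (h0 i) (h1 j)) (M.mul_mem (h0 j) (h1 i))) h01
  have hle : IntermediateField.adjoin K (edgeBinoms K G) ≤ M := by
    rw [IntermediateField.adjoin_le_iff]
    intro z hz
    obtain ⟨i, j, -, rfl⟩ := (mem_edgeBinoms K G z).1 hz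
    exact hp i j
  calc spread K G ≤ Algebra.trdeg K M :=
        trdeg_le_of_injective (IntermediateField.inclusion hle)
          (IntermediateField.inclusion_injective hle)
    _ ≤ Cardinal.mk (Set.range g) := trdeg_field_adjoin_le K _ _
    _ ≤ Cardinal.mk (Option (Fin m ⊕ Fin m)) := Cardinal.mk_range_le
    _ = ((2 * m + 1 : ℕ) : Cardinal) := by
        rw [Cardinal.mk_fintype]; congr 1; simp; ring

lemma spread_lower (K : Type) [Field K] (m : ℕ) (G : SimpleGraph (Fin (m + 2)))
    (hG : G.Connected) : ((m + 1 : ℕ) : Cardinal) ≤ spread K G := by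
  let F := FractionRing (MvPolynomial (Fin (m+2) ⊕ Fin (m+2)) K)
  let L : IntermediateField K F := IntermediateField.adjoin K (edgeBinoms K G)
  let g : Option (Fin (m+2)) → F := fun o => o.elim (yv K 0) (fun i => xv K i)
  let M : IntermediateField L F := IntermediateField.adjoin L (Set.range g)
  have hg : ∀ o, g o ∈ M := fun o => IntermediateField.subset_adjoin _ _ ⟨o, rfl⟩
  have hL : ∀ z ∈ L, z ∈ M := fun z hz => M.algebraMap_mem (⟨z, hz⟩ : L)
  have hx : ∀ i, xv K i ∈ M := fun i => hg (some i)
  have hy : ∀ i, yv K i ∈ M := by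
    have key : ∀ i j (w : G.Walk i j), yv K j ∈ M → yv K i ∈ M := by
     intro i j w hj
     induction w with
     | nil => exact hj
     | @cons u v w h _ ih =>
       have hb : xv K u * yv K v - xv K v * yv K u ∈ M :=
         hL _ (IntermediateField.subset_adjoin _ _ ((mem_edgeBinoms K G _).2 ⟨u, v, h, rfl⟩))
       have : yv K u = (xv K u * yv K v - (xv K u * yv K v - xv K v * yv K u)) / xv K v := by
         rw [eq_div_iff (xv_ne_zero K v)]; ring
       rw [this]
       exact M.div_mem (M.sub_mem (M.mul_mem (hx u) (ih hj)) hb) (hx v)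
    intro i
    obtain ⟨w⟩ := hG.preconnected i 0
    exact key _ _ w (hg none)
  have htop : M = ⊤ := by
    rw [eq_top_iff]
    intro z _
    refine fractionRing_subfield_top M.toSubfield ?_ ?_ z
    · intro a
      exact hL _ (L.algebraMap_mem a)
    · rintro (i | i)
      · exact hx i
      · exact hy i
  have h1 : Algebra.trdeg L F ≤ ((m + 3 : ℕ) : Cardinal) := by
    calc Algebra.trdeg L F = Algebra.trdeg L M := by
          rw [htop]; exact (IntermediateField.topEquiv (F := L) (E := F)).trdeg_eq.symm
      _ ≤ Cardinal.mk (Set.range g) := trdeg_field_adjoin_le L F _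
      _ ≤ Cardinal.mk (Option (Fin (m+2))) := Cardinal.mk_range_le
      _ = _ := by rw [Cardinal.mk_fintype]; congr 1; simp
  have h2 : ((2 * m + 4 : ℕ) : Cardinal) ≤ Algebra.trdeg K F := by
    have := trdeg_le_of_injective
      (IsScalarTower.toAlgHom K (MvPolynomial (Fin (m+2) ⊕ Fin (m+2)) K) F)
      (IsFractionRing.injective (MvPolynomial (Fin (m+2) ⊕ Fin (m+2)) K) F)
    refine le_trans (le_of_eq ?_) this
    rw [MvPolynomial.trdeg_of_isDomain, Cardinal.mk_fintype]
    simp only [Fintype.card_sum, Fintype.card_fin, Cardinal.lift_natCast]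
    congr 1; ring
  have h3 : Algebra.trdeg K L + Algebra.trdeg L F = Algebra.trdeg K F :=
    trdeg_add_eq K L (A := F)
  change _ ≤ Algebra.trdeg K L
  rw [← h3] at h2
  by_contra hcon
  rw [not_le] at hcon
  obtain ⟨a, ha⟩ := Cardinal.lt_aleph0.1 (hcon.trans (Cardinal.natCast_lt_aleph0))
  rw [ha] at hcon h2
  have h4 := h2.trans (add_le_add_right h1 _)
  norm_cast at h4 hcon
  omega

/-- For a connected graph `G` on `n ≥ 2` vertices, `n − 1 ≤ ℓ(J_G) ≤ 2n − 3`. -/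
theorem spread_bounds_of_connected
    (K : Type) [Field K] [Infinite K] (n : ℕ) (hn : 2 ≤ n)
    (G : SimpleGraph (Fin n)) (hG : G.Connected) :
    ((n - 1 : ℕ) : Cardinal) ≤ spread K G ∧ spread K G ≤ ((2 * n - 3 : ℕ) : Cardinal) := by
  obtain ⟨m, rfl⟩ : ∃ m, n = m + 2 := ⟨n - 2, by omega⟩
  have e1 : m + 2 - 1 = m + 1 := by omega
  have e2 : 2 * (m + 2) - 3 = 2 * m + 1 := by omega
  rw [e1, e2]
  exact ⟨spread_lower K m G hG, spread_upper K m G⟩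
end

section
/- For the n-cycle C_n, the analytic spread of its binomial edge ideal equals n: ℓ(J_{C_n}) = n. Equivalently, the n binomials x_1 y_2 − x_2 y_1, x_2 y_3 − x_3 y_2, ..., x_{n-1} y_n − x_n y_{n-1}, x_n y_1 − x_1 y_n are algebraically independent over K. -/
open MvPolynomial

/-- Existence of points realising any prescribed generic values of the cyclic minors. -/
lemma exists_points {F : Type} [Field F] (n : ℕ) (hn : 3 ≤ n) (t : ℕ → F)
    (h0 : t 0 ≠ 0) :
    ∃ x y : ℕ → F, (∀ i, i + 1 < n → x i * y (i + 1) - x (i + 1) * y i = t i) ∧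
      x (n - 1) * y 0 - x 0 * y (n - 1) = t (n - 1) := by
  let y : ℕ → F := fun i =>
    if i = 0 then 0 else if i = 1 then t 0 else if i = n - 1 then - t (n - 1) else 1
  let x : ℕ → F := fun i => Nat.rec 1 (fun i xi => (xi * y (i + 1) - t i) / y i) i
  have hx0 : x 0 = 1 := rfl
  have hxs : ∀ i, x (i + 1) = (x i * y (i + 1) - t i) / y i := fun i => rfl
  have hy0 : y 0 = 0 := rfl
  have hy1 : y 1 = t 0 := rfl
  refine ⟨x, y, ?_, ?_⟩
  · intro i hi
    rcases Nat.eq_zero_or_pos i with rfl | hpos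
    · simp [hx0, hy0, hy1]
    · have hy : y i ≠ 0 := by
        by_cases h1 : i = 1
        · subst h1; exact h0
        · have : y i = 1 := by
            simp only [y]
            rw [if_neg (by omega), if_neg h1, if_neg (by omega)]
          rw [this]; exact one_ne_zero
      rw [hxs]
      field_simp
      ring
  · have : y (n - 1) = - t (n - 1) := by
      simp only [y]
      rw [if_neg (by omega), if_neg (by omega), if_pos trivial]
    rw [this, hy0, hx0]; ring

lemma binoms_indep (K : Type) [Field K] (n : ℕ) [NeZero n] (hn : 3 ≤ n) :
    AlgebraicIndependent K (fun i : Fin n =>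
      (X (Sum.inl i) * X (Sum.inr (i + 1)) - X (Sum.inl (i + 1)) * X (Sum.inr i) :
        MvPolynomial (Fin n ⊕ Fin n) K)) := by
  let F := FractionRing (MvPolynomial (Fin n) K)
  let t : ℕ → F := fun i => algebraMap (MvPolynomial (Fin n) K) F (X (Fin.ofNat n i))
  have h0 : t 0 ≠ 0 := by
    intro h
    have := (FaithfulSMul.algebraMap_injective (MvPolynomial (Fin n) K) F)
      (h.trans (map_zero _).symm)
    exact X_ne_zero _ this
  obtain ⟨x, y, h1, h2⟩ := exists_points n hn t h0
  refine AlgebraicIndependent.of_comp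
    (aeval (Sum.elim (fun i : Fin n => x i) (fun i : Fin n => y i)) :
      MvPolynomial (Fin n ⊕ Fin n) K →ₐ[K] F) ?_
  have key : (⇑(aeval (Sum.elim (fun i : Fin n => x i) (fun i : Fin n => y i)) :
      MvPolynomial (Fin n ⊕ Fin n) K →ₐ[K] F) ∘ (fun i : Fin n =>
      (X (Sum.inl i) * X (Sum.inr (i + 1)) - X (Sum.inl (i + 1)) * X (Sum.inr i) :
        MvPolynomial (Fin n ⊕ Fin n) K))) =
      (IsScalarTower.toAlgHom K (MvPolynomial (Fin n) K) F) ∘ X := by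
    funext i
    have ht : t i = algebraMap (MvPolynomial (Fin n) K) F (X i) := by
      simp [t]
    have hv : ((i + 1 : Fin n) : ℕ) = (i.val + 1) % n := by
      rw [Fin.val_add, Fin.val_one', Nat.add_mod_mod]
    simp only [Function.comp_apply, map_sub, map_mul, aeval_X, Sum.elim_inl, Sum.elim_inr,
      IsScalarTower.coe_toAlgHom', ← ht]
    rcases Nat.lt_or_ge (i.val + 1) n with h | h
    · rw [hv, Nat.mod_eq_of_lt h]
      exact h1 _ h
    · have e : i.val = n - 1 := by have := i.isLt; omega
      have e2 : ((i + 1 : Fin n) : ℕ) = 0 := by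
        rw [hv, e, Nat.sub_add_cancel (by omega), Nat.mod_self]
      rw [e2, e]
      exact h2
  rw [key]
  exact (MvPolynomial.algebraicIndependent_X (Fin n) K).map'
    (FaithfulSMul.algebraMap_injective (MvPolynomial (Fin n) K) F)

lemma trdeg_adjoin_of_indep {K L : Type} [Field K] [Field L] [Algebra K L] {n : ℕ}
    (f : Fin n → L) (hf : AlgebraicIndependent K f) :
    Algebra.trdeg K (IntermediateField.adjoin K (Set.range f)) = n := by
  let E := IntermediateField.adjoin K (Set.range f)
  let g : Fin n → E := fun i =>
    ⟨f i, IntermediateField.subset_adjoin K _ (Set.mem_range_self i)⟩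
  have hg : AlgebraicIndependent K g := AlgebraicIndependent.of_comp E.val hf
  have htop : IntermediateField.adjoin K (Set.range g) = ⊤ := by
    apply IntermediateField.lift_injective E
    rw [IntermediateField.lift_adjoin, IntermediateField.lift_top, ← Set.range_comp]
    rfl
  have halg : Algebra.IsAlgebraic (Algebra.adjoin K (Set.range g)) E := by
    rw [← IntermediateField.isAlgebraic_adjoin_iff_top, htop,
      Algebra.isAlgebraic_iff_isIntegral]
    exact Algebra.isIntegral_of_surjective IntermediateField.topEquiv.surjective
  apply le_antisymm
  · refine (Algebra.IsAlgebraic.trdeg_le_cardinalMk K (Set.range g)).trans ?_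
    refine Cardinal.mk_range_le.trans ?_
    simp
  · simpa using hg.cardinalMk_le_trdeg

lemma edgeBinoms_adjoin (K : Type) [Field K] (n : ℕ) [NeZero n] (hn : 3 ≤ n) :
    IntermediateField.adjoin K
      (edgeBinoms K (SimpleGraph.fromRel (fun i j : Fin n => j = i + 1))) =
    IntermediateField.adjoin K (Set.range (fun i : Fin n =>
      algebraMap (MvPolynomial (Fin n ⊕ Fin n) K)
        (FractionRing (MvPolynomial (Fin n ⊕ Fin n) K))
        (X (Sum.inl i) * X (Sum.inr (i + 1)) - X (Sum.inl (i + 1)) * X (Sum.inr i)))) := by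
  apply le_antisymm
  · rw [IntermediateField.adjoin_le_iff]
    rintro z ⟨i, j, hij, rfl⟩
    rw [SimpleGraph.fromRel_adj] at hij
    obtain ⟨_, rfl | rfl⟩ := hij
    · exact IntermediateField.subset_adjoin K _ (Set.mem_range_self i)
    · rw [← neg_sub, map_neg]
      exact neg_mem (IntermediateField.subset_adjoin K _ (Set.mem_range_self j))
  · apply IntermediateField.adjoin.mono
    rintro _ ⟨i, rfl⟩
    refine ⟨i, i + 1, ?_, rfl⟩
    rw [SimpleGraph.fromRel_adj]
    refine ⟨?_, Or.inl rfl⟩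
    intro h
    have hv : ((i + 1 : Fin n) : ℕ) = (i.val + 1) % n := by
      rw [Fin.val_add, Fin.val_one', Nat.add_mod_mod]
    rw [← h] at hv
    have hi := i.isLt
    rcases Nat.lt_or_ge (i.val + 1) n with h' | h'
    · rw [Nat.mod_eq_of_lt h'] at hv; omega
    · rw [show i.val + 1 = n by omega, Nat.mod_self] at hv; omega

/-- For the `n`-cycle `Cₙ` (`n ≥ 3`), with vertices `0,…,n−1` and edges `{i, i+1 mod n}`,
the analytic spread of its binomial edge ideal is `n`. -/
theorem spread_cycle
    (K : Type) [Field K] [Infinite K] (n : ℕ) [NeZero n] (hn : 3 ≤ n)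
    (C : SimpleGraph (Fin n))
    (hC : C = SimpleGraph.fromRel (fun i j : Fin n => j = i + 1)) :
    spread K C = (n : Cardinal) := by
  subst hC
  unfold spread
  rw [edgeBinoms_adjoin K n hn]
  exact trdeg_adjoin_of_indep _ ((binoms_indep K n hn).map'
    (f := IsScalarTower.toAlgHom K (MvPolynomial (Fin n ⊕ Fin n) K)
      (FractionRing (MvPolynomial (Fin n ⊕ Fin n) K)))
    (FaithfulSMul.algebraMap_injective _ _))
end

section
/- Let G be a connected unicyclic graph (connected with exactly one cycle). Then ℓ(J_G) = |E(G)|; equivalently, the edge binomials of G are algebraically independent over K. -/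
open MvPolynomial

namespace SpreadUni

/-- Recursion along a walk to the root. -/
def walkRec {V K : Type} {T : SimpleGraph V} (g : V → V → K → K) (a : K) :
    {v r : V} → T.Walk v r → K
  | _, _, .nil => a
  | v, _, .cons (v := u) _ p => g u v (walkRec g a p)

theorem exists_rec {V K : Type} {T : SimpleGraph V} (hT : T.IsAcyclic) (hc : T.Connected)
    (r : V) (g : V → V → K → K) (a : K) :
    ∃ x : V → K, x r = a ∧ ∀ u v, T.Adj u v → (x v = g u v (x u) ∨ x u = g v u (x v)) := by
  classical
  have hp : ∀ v, ∃ p : T.Walk v r, p.IsPath := fun v => (hc v r).exists_isPath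
  choose P hP using hp
  have huniq : ∀ {v w : V} (p q : T.Walk v w), p.IsPath → q.IsPath → p = q := fun p q h1 h2 =>
    congrArg Subtype.val ((hT.subsingleton_path _ _).elim ⟨p, h1⟩ ⟨q, h2⟩)
  refine ⟨fun v => walkRec g a (P v), ?_, ?_⟩
  · show walkRec g a (P r) = a
    rw [huniq (P r) .nil (hP r) (by simp)]
    rfl
  · intro u v h
    by_cases hv : v ∈ (P u).support
    · right
      have h1 : (P u).takeUntil v hv = .cons h .nil :=
        huniq _ _ ((hP u).takeUntil hv) (by simp [h.ne])
      have h2 : (P u).dropUntil v hv = P v := huniq _ _ ((hP u).dropUntil hv) (hP v)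
      have h3 := (P u).take_spec hv
      rw [h1, h2] at h3
      simp only [SimpleGraph.Walk.cons_append, SimpleGraph.Walk.nil_append] at h3
      show walkRec g a (P u) = _
      rw [← h3]
      rfl
    · left
      have h1 : P v = .cons h.symm (P u) :=
        huniq _ _ (hP v) ((SimpleGraph.Walk.cons_isPath_iff _ _).2 ⟨hP u, hv⟩)
      show walkRec g a (P v) = _
      rw [h1]
      rfl

theorem exists_point {K V : Type} [Field K] (G : SimpleGraph V) (hconn : G.Connected)
    (hcyc : ¬ G.IsAcyclic) (hone : ∃ e ∈ G.edgeSet, (G.deleteEdges {e}).IsAcyclic)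
    (c : V → V → K) (hc0 : ∀ u v, G.Adj u v → c u v ≠ 0)
    (hanti : ∀ u v, G.Adj u v → c v u = - c u v) :
    ∃ x y : V → K, ∀ u v, G.Adj u v → x u * y v - x v * y u = c u v := by
  classical
  obtain ⟨e, he, hac⟩ := hone
  induction e with | h r b
  have hnb : ¬ G.IsBridge s(r, b) := by
    intro hb
    apply hcyc
    intro v p hp
    have hne := hb.notMem_edges_of_isCycle hp
    refine hac (p.toDeleteEdges {s(r, b)} ?_) ?_
    · intro e he h
      rw [Set.mem_singleton_iff] at h
      exact hne (h ▸ he)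
    · exact hp.toDeleteEdges _ _ _
  have hTc : (G.deleteEdges {s(r, b)}).Connected := hconn.connected_delete_edge_of_not_isBridge hnb
  let y : V → K := fun v => if v = r then 0 else if G.Adj r v then c r v else 1
  have hyr : y r = 0 := by simp [y]
  have hy0 : ∀ v, v ≠ r → y v ≠ 0 := by
    intro v hv
    simp only [y, if_neg hv]
    split_ifs with h
    · exact hc0 _ _ h
    · exact one_ne_zero
  have hya : ∀ v, G.Adj r v → y v = c r v := by
    intro v hv
    simp [y, hv, hv.ne']
  obtain ⟨x, hxr, hx⟩ := exists_rec hac hTc r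
    (fun u v xu => (xu * y v - c u v) / y u) (1 : K)
  refine ⟨x, y, fun u v h => ?_⟩
  by_cases hu : u = r
  · subst hu
    rw [hxr, hyr, hya v h]; ring
  by_cases hv : v = r
  · subst hv
    rw [hxr, hyr, hya u h.symm, hanti u v h]; ring
  have hadj : (G.deleteEdges {s(r, b)}).Adj u v := by
    rw [SimpleGraph.deleteEdges_adj]
    refine ⟨h, fun h' => ?_⟩
    have := Set.mem_singleton_iff.1 h'
    rw [Sym2.eq_iff] at this
    tauto
  rcases hx u v hadj with h1 | h1
  · rw [h1]
    field_simp [hy0 u hu]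
    ring
  · rw [h1, hanti u v h]
    have := hy0 v hv
    field_simp
    ring

/-- The oriented binomial of an edge. -/
noncomputable def edgePoly (K : Type) [Field K] {V : Type} (e : Sym2 V) :
    MvPolynomial (V ⊕ V) K :=
  X (Sum.inl (Quot.out e).1) * X (Sum.inr (Quot.out e).2)
    - X (Sum.inl (Quot.out e).2) * X (Sum.inr (Quot.out e).1)

theorem mk_out {V : Type} (e : Sym2 V) : s((Quot.out e).1, (Quot.out e).2) = e := Quot.out_eq e

theorem edgePoly_indep {K V : Type} [Field K] [Infinite K] (G : SimpleGraph V) (hconn : G.Connected)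
    (hcyc : ¬ G.IsAcyclic) (hone : ∃ e ∈ G.edgeSet, (G.deleteEdges {e}).IsAcyclic) :
    AlgebraicIndependent K (fun e : G.edgeSet => edgePoly K e.1) := by
  classical
  rw [algebraicIndependent_iff]
  intro P hP
  refine MvPolynomial.funext_set (fun _ => {0}ᶜ) (fun _ => (Set.finite_singleton _).infinite_compl)
    fun c hc => ?_
  have hc0 : ∀ e, c e ≠ 0 := fun e => by simpa using hc e trivial
  let C : V → V → K := fun u v =>
    if h : s(u, v) ∈ G.edgeSet then
      (if (Quot.out s(u, v)) = (u, v) then c ⟨_, h⟩ else - c ⟨_, h⟩) else 0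
  obtain ⟨x, y, hxy⟩ := exists_point G hconn hcyc hone C
    (by
      intro u v h
      have h' : s(u, v) ∈ G.edgeSet := h
      simp only [C, dif_pos h']
      split_ifs
      · exact hc0 _
      · exact neg_ne_zero.2 (hc0 _))
    (by
      intro u v h
      have h' : s(u, v) ∈ G.edgeSet := h
      have hs : s(v, u) = s(u, v) := Sym2.eq_swap
      have h3 := mk_out s(u, v)
      have hne := h.ne
      simp only [C, hs, dif_pos h']
      rw [Sym2.eq_iff] at h3
      rcases h3 with h3 | h3
      · have h4 : Quot.out s(u, v) = (u, v) := Prod.ext h3.1 h3.2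
        rw [h4]; simp [hne]
      · have h4 : Quot.out s(u, v) = (v, u) := Prod.ext h3.1 h3.2
        rw [h4]; simp [hne.symm])
  have key : ∀ e : G.edgeSet, aeval (Sum.elim x y) (edgePoly K e.1) = c e := by
    intro e
    have he : s((Quot.out e.1).1, (Quot.out e.1).2) ∈ G.edgeSet := by rw [mk_out]; exact e.2
    have := hxy _ _ he
    simp only [edgePoly, map_sub, map_mul, aeval_X, Sum.elim_inl, Sum.elim_inr]
    rw [this]
    simp only [C, mk_out, Prod.mk.eta, dif_pos e.2, if_true]
  have h := congrArg (aeval (Sum.elim x y)) hP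
  rw [map_zero, ← AlgHom.comp_apply, comp_aeval] at h
  simp only [key] at h
  rw [map_zero]
  rw [← h, ← coe_aeval_eq_eval]
  rfl

theorem trdeg_adjoin {K L ι : Type} [Field K] [Field L] [Algebra K L] {x : ι → L}
    (hx : AlgebraicIndependent K x) :
    trdeg K (IntermediateField.adjoin K (Set.range x)) = Cardinal.mk ι := by
  have h1 : IsTranscendenceBasis K (fun i : ι => (X i : MvPolynomial ι K)) :=
    IsTranscendenceBasis.mvPolynomial ι K
  have : Algebra.IsAlgebraic (MvPolynomial ι K) (FractionRing (MvPolynomial ι K)) :=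
    IsLocalization.isAlgebraic _ (nonZeroDivisors (MvPolynomial ι K))
  have h2 := h1.algebraMap_comp (A := FractionRing (MvPolynomial ι K))
  have h3 := hx.aevalEquivField.isTranscendenceBasis h2
  exact h3.cardinalMk_eq_trdeg.symm

end SpreadUni

/-- If `G` is a connected unicyclic graph (connected, not acyclic, and deleting a single
suitable edge makes it acyclic, i.e. it has exactly one cycle), then `ℓ(J_G) = |E(G)|`. -/
theorem spread_unicyclic
    (K : Type) [Field K] [Infinite K] (n : ℕ) (G : SimpleGraph (Fin n))
    (hconn : G.Connected) (hcyc : ¬ G.IsAcyclic)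
    (hone : ∃ e ∈ G.edgeSet, (G.deleteEdges {e}).IsAcyclic) :
    spread K G = (G.edgeSet.ncard : Cardinal) := by
  have hind := SpreadUni.edgePoly_indep (K := K) G hconn hcyc hone
  have hind2 : AlgebraicIndependent K (fun e : G.edgeSet =>
      algebraMap (MvPolynomial (Fin n ⊕ Fin n) K)
        (FractionRing (MvPolynomial (Fin n ⊕ Fin n) K)) (SpreadUni.edgePoly K e.1)) :=
    hind.map' (f := IsScalarTower.toAlgHom K _ _)
      (IsFractionRing.injective (MvPolynomial (Fin n ⊕ Fin n) K) _)
  have hadj : IntermediateField.adjoin K (edgeBinoms K G) =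
      IntermediateField.adjoin K (Set.range (fun e : G.edgeSet =>
      algebraMap (MvPolynomial (Fin n ⊕ Fin n) K)
        (FractionRing (MvPolynomial (Fin n ⊕ Fin n) K)) (SpreadUni.edgePoly K e.1))) := by
    apply le_antisymm
    · rw [IntermediateField.adjoin_le_iff]
      rintro z ⟨i, j, hij, rfl⟩
      have hm := IntermediateField.subset_adjoin K _ (Set.mem_range_self
        (f := (fun e : G.edgeSet => algebraMap (MvPolynomial (Fin n ⊕ Fin n) K)
        (FractionRing (MvPolynomial (Fin n ⊕ Fin n) K)) (SpreadUni.edgePoly K e.1)))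
        ⟨s(i, j), hij⟩)
      have h3 := SpreadUni.mk_out s(i, j)
      rw [Sym2.eq_iff] at h3
      rcases h3 with ⟨h3, h4⟩ | ⟨h3, h4⟩
      · simp only [SpreadUni.edgePoly, h3, h4] at hm
        exact hm
      · simp only [SpreadUni.edgePoly, h3, h4] at hm
        have := neg_mem hm
        rw [← map_neg, neg_sub] at this
        exact this
    · apply IntermediateField.adjoin.mono
      rintro z ⟨e, rfl⟩
      refine ⟨(Quot.out e.1).1, (Quot.out e.1).2, ?_, rfl⟩
      rw [← SimpleGraph.mem_edgeSet, SpreadUni.mk_out]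
      exact e.2
  unfold spread
  rw [hadj, SpreadUni.trdeg_adjoin hind2, ← Set.cast_ncard (Set.toFinite _)]
end

section
/- Let G be a closed graph on n vertices. Then ℓ(J_G) ≤ |E(G)|, with equality ℓ(J_G) = |E(G)| if and only if G contains no induced complete graph K_4. -/
open MvPolynomial

/-- A graph on `{0,…,n−1}` is closed (with respect to this labeling) if whenever two edges
share a vertex which is either smaller than both other endpoints or larger than both, those
two other endpoints are adjacent.  This is the standard combinatorial characterization of
the graphs whose binomial edge ideal has a quadratic Gröbner basis w.r.t. a diagonal term
order. -/
def IsClosedGraph {n : ℕ} (G : SimpleGraph (Fin n)) : Prop :=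
  ∀ i j k : Fin n, G.Adj i j → G.Adj i k → j ≠ k →
    ((i < j ∧ i < k) ∨ (j < i ∧ k < i)) → G.Adj j k

/-- `G` contains an induced `K₄`, i.e. four pairwise adjacent vertices. -/
def HasInducedK4 {n : ℕ} (G : SimpleGraph (Fin n)) : Prop :=
  ∃ a b c d : Fin n, G.Adj a b ∧ G.Adj a c ∧ G.Adj a d ∧ G.Adj b c ∧ G.Adj b d ∧ G.Adj c d


namespace SpreadProof

open Cardinal

theorem trdeg_eq (K L : Type*) [CommRing K] [CommRing L] [Algebra K L] :
    _root_.trdeg K L = Algebra.trdeg K L := rfl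

theorem alg_of_adjoin_eq_top {K F ι : Type*} [Field K] [Field F] [Algebra K F] (x : ι → F)
    (h : IntermediateField.adjoin K (Set.range x) = ⊤) :
    Algebra.IsAlgebraic (Algebra.adjoin K (Set.range x)) F := by
  rw [← IntermediateField.isAlgebraic_adjoin_iff_top, h]
  exact ⟨fun a => isAlgebraic_algebraMap (⟨a, trivial⟩ : (⊤ : IntermediateField K F))⟩

/-- Ordered edges. -/
abbrev E {n : ℕ} (G : SimpleGraph (Fin n)) : Type :=
  {p : Fin n × Fin n // p.1 < p.2 ∧ G.Adj p.1 p.2}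

theorem card_E {n : ℕ} (G : SimpleGraph (Fin n)) : #(E G) = (G.edgeSet.ncard : Cardinal) := by
  rw [← Nat.card_coe_set_eq, Nat.cast_card]
  refine Cardinal.mk_congr (Equiv.ofBijective
    (fun p : E G => (⟨s(p.1.1, p.1.2), p.2.2⟩ : G.edgeSet)) ⟨?_, ?_⟩)
  · rintro ⟨⟨a, b⟩, h1, h2⟩ ⟨⟨c, d⟩, h3, h4⟩ h
    have h := Sym2.eq_iff.mp (congrArg Subtype.val h)
    simp only at h
    rcases h with ⟨rfl, rfl⟩ | ⟨rfl, rfl⟩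
    · rfl
    · exact absurd h1 (not_lt.mpr h3.le)
  · rintro ⟨e, he⟩
    induction e with
    | h a b =>
      have hab : G.Adj a b := he
      rcases lt_or_gt_of_ne hab.ne with h | h
      · exact ⟨⟨(a, b), h, hab⟩, rfl⟩
      · exact ⟨⟨(b, a), h, hab.symm⟩, Subtype.ext Sym2.eq_swap⟩

variable (K : Type) [Field K]

abbrev L (n : ℕ) : Type := FractionRing (MvPolynomial (Fin n ⊕ Fin n) K)

/-- The variables in the fraction field. -/
noncomputable def vx {n : ℕ} (s : Fin n ⊕ Fin n) : L K n :=
  algebraMap (MvPolynomial (Fin n ⊕ Fin n) K) (L K n) (X s)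

/-- The minors in the fraction field. -/
noncomputable def mf {n : ℕ} (i j : Fin n) : L K n :=
  vx K (Sum.inl i) * vx K (Sum.inr j) - vx K (Sum.inl j) * vx K (Sum.inr i)

theorem mf_eq {n : ℕ} (i j : Fin n) : mf K i j =
    algebraMap (MvPolynomial (Fin n ⊕ Fin n) K) (L K n)
      (X (Sum.inl i) * X (Sum.inr j) - X (Sum.inl j) * X (Sum.inr i)) := by
  simp [mf, vx]

theorem mf_swap {n : ℕ} (i j : Fin n) : mf K i j = - mf K j i := by
  simp only [mf]; ring

theorem vx_ne_zero {n : ℕ} (s : Fin n ⊕ Fin n) : vx K s ≠ 0 := by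
  unfold vx
  rw [Ne, FaithfulSMul.algebraMap_eq_zero_iff]
  exact X_ne_zero s

theorem mf_inj {n : ℕ} {i j k : Fin n} (hij : i ≠ j) (h : mf K i j = mf K i k) : j = k := by
  by_contra hjk
  rw [mf_eq, mf_eq] at h
  have h := IsFractionRing.injective (MvPolynomial (Fin n ⊕ Fin n) K) (L K n) h
  have h2 := congrArg (MvPolynomial.eval
    (Sum.elim (Pi.single i (1 : K)) (Pi.single j (1 : K)))) h
  simp [Pi.single_apply, hij, hij.symm, Ne.symm hjk] at h2

theorem mf_ne_zero {n : ℕ} {i j : Fin n} (hij : i ≠ j) : mf K i j ≠ 0 := by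
  intro h
  have : mf K i j = mf K i i := by rw [h, mf]; ring
  exact hij (mf_inj K hij this).symm

theorem vx_basis (n : ℕ) : IsTranscendenceBasis K (vx K : Fin n ⊕ Fin n → L K n) :=
  have : Algebra.IsAlgebraic (MvPolynomial (Fin n ⊕ Fin n) K) (L K n) :=
    IsLocalization.isAlgebraic _ (nonZeroDivisors (MvPolynomial (Fin n ⊕ Fin n) K))
  (IsTranscendenceBasis.mvPolynomial (Fin n ⊕ Fin n) K).algebraMap_comp

theorem vx_gen (n : ℕ) (F : IntermediateField K (L K n)) (h : ∀ s, vx K s ∈ F) : F = ⊤ := by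
  have hp : ∀ p : MvPolynomial (Fin n ⊕ Fin n) K, algebraMap _ (L K n) p ∈ F := by
    intro p
    induction p using MvPolynomial.induction_on with
    | C a => exact F.algebraMap_mem a
    | add p q hp hq => rw [map_add]; exact F.add_mem hp hq
    | mul_X p i hp => rw [map_mul]; exact F.mul_mem hp (h i)
  rw [eq_top_iff]
  rintro z -
  obtain ⟨a, b, -, rfl⟩ := IsFractionRing.div_surjective (A := MvPolynomial (Fin n ⊕ Fin n) K) z
  exact F.div_mem (hp a) (hp b)

/-- local choice at a vertex -/
theorem local_choice {n : ℕ} (G : SimpleGraph (Fin n)) (hclosed : IsClosedGraph G)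
    (hK : ¬ HasInducedK4 G) (i : Fin n) :
    ∃ g : Fin 2 → L K n, (∀ j, i < j → G.Adj i j → mf K i j ∈ Set.range g) ∧
      ∀ F : IntermediateField K (L K n), (∀ j, i < j → vx K (Sum.inl j) ∈ F ∧ vx K (Sum.inr j) ∈ F) →
        (∀ t, g t ∈ F) → vx K (Sum.inl i) ∈ F ∧ vx K (Sum.inr i) ∈ F := by
  by_cases h1 : ∃ j, i < j ∧ G.Adj i j
  swap
  · refine ⟨![vx K (Sum.inl i), vx K (Sum.inr i)], fun j hj ha => absurd ⟨j, hj, ha⟩ h1, ?_⟩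
    intro F _ hg
    exact ⟨hg 0, hg 1⟩
  obtain ⟨j, hij, aij⟩ := h1
  by_cases h2 : ∃ k, i < k ∧ G.Adj i k ∧ j ≠ k
  swap
  · push Not at h2
    refine ⟨![mf K i j, vx K (Sum.inl i)], fun k hk ha => ⟨0, by simp [h2 k hk ha]⟩, ?_⟩
    intro F hF hg
    have hx : vx K (Sum.inl i) ∈ F := hg 1
    have hm : mf K i j ∈ F := hg 0
    refine ⟨hx, ?_⟩
    have : vx K (Sum.inr i) =
        (vx K (Sum.inl i) * vx K (Sum.inr j) - mf K i j) / vx K (Sum.inl j) := by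
      rw [eq_div_iff (vx_ne_zero K _), mf]; ring
    rw [this]
    exact F.div_mem (F.sub_mem (F.mul_mem hx (hF j hij).2) hm) (hF j hij).1
  obtain ⟨k, hik, aik, hjk⟩ := h2
  have ajk : G.Adj j k := hclosed i j k aij aik hjk (Or.inl ⟨hij, hik⟩)
  refine ⟨![mf K i j, mf K i k], fun l hl ha => ?_, ?_⟩
  · by_cases hlj : j = l
    · exact ⟨0, by simp [hlj]⟩
    by_cases hlk : k = l
    · exact ⟨1, by simp [hlk]⟩
    exact absurd ⟨i, j, k, l, aij, aik, ha, ajk, hclosed i j l aij ha hlj (Or.inl ⟨hij, hl⟩),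
      hclosed i k l aik ha hlk (Or.inl ⟨hik, hl⟩)⟩ hK
  · intro F hF hg
    have hm : mf K i j ∈ F := hg 0
    have hm' : mf K i k ∈ F := hg 1
    obtain ⟨xj, yj⟩ := hF j hij
    obtain ⟨xk, yk⟩ := hF k hik
    have hd : mf K k j ∈ F := F.sub_mem (F.mul_mem xk yj) (F.mul_mem xj yk)
    have hd0 : mf K k j ≠ 0 := mf_ne_zero K (Ne.symm hjk)
    constructor
    · have : vx K (Sum.inl i) =
        (vx K (Sum.inl k) * mf K i j - vx K (Sum.inl j) * mf K i k) / mf K k j := by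
        rw [eq_div_iff hd0]; simp only [mf]; ring
      rw [this]
      exact F.div_mem (F.sub_mem (F.mul_mem xk hm) (F.mul_mem xj hm')) hd
    · have : vx K (Sum.inr i) =
        (vx K (Sum.inr k) * mf K i j - vx K (Sum.inr j) * mf K i k) / mf K k j := by
        rw [eq_div_iff hd0]; simp only [mf]; ring
      rw [this]
      exact F.div_mem (F.sub_mem (F.mul_mem yk hm) (F.mul_mem yj hm')) hd

theorem indep_of_K4_free {n : ℕ} (G : SimpleGraph (Fin n)) (hclosed : IsClosedGraph G)
    (hK : ¬ HasInducedK4 G) :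
    AlgebraicIndependent K (fun p : E G => mf K p.1.1 p.1.2) := by
  choose g hg1 hg2 using local_choice K G hclosed hK
  let g' : Fin n × Fin 2 → L K n := fun q => g q.1 q.2
  have htop : IntermediateField.adjoin K (Set.range g') = ⊤ := by
    have key : ∀ m : ℕ, ∀ i : Fin n, n - i.1 = m →
        vx K (Sum.inl i) ∈ IntermediateField.adjoin K (Set.range g') ∧
        vx K (Sum.inr i) ∈ IntermediateField.adjoin K (Set.range g') := by
      intro m
      induction m using Nat.strong_induction_on with
      | _ m ih =>
        intro i hi
        refine hg2 i _ (fun j hj => ih (n - j.1) (by omega) j rfl) (fun t => ?_)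
        exact IntermediateField.subset_adjoin K _ ⟨(i, t), rfl⟩
    refine vx_gen K n _ ?_
    rintro (i | i)
    · exact (key _ i rfl).1
    · exact (key _ i rfl).2
  have := alg_of_adjoin_eq_top g' htop
  have hb : IsTranscendenceBasis K g' := by
    refine Algebra.IsAlgebraic.isTranscendenceBasis_of_le_trdeg_of_finite K g' ?_
    rw [← (vx_basis K n).cardinalMk_eq_trdeg]
    simp [mul_two]
  have : ∀ p : E G, ∃ t, g p.1.1 t = mf K p.1.1 p.1.2 := fun p => hg1 _ _ p.2.1 p.2.2
  choose t ht using this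
  have h := hb.1.comp (fun p : E G => (p.1.1, t p)) ?_
  · convert h using 1
    funext p
    exact (ht p).symm
  · rintro ⟨⟨a, b⟩, h1, h2⟩ ⟨⟨c, d⟩, h3, h4⟩ h
    simp only [Prod.mk.injEq] at h
    obtain ⟨rfl, h⟩ := h
    have e1 := ht ⟨⟨a, b⟩, h1, h2⟩
    have e2 := ht ⟨⟨a, d⟩, h3, h4⟩
    rw [h] at e1
    have : b = d := mf_inj K h2.ne (e1.symm.trans e2)
    subst this
    rfl

theorem not_indep_of_K4 {n : ℕ} (G : SimpleGraph (Fin n)) (hK : HasInducedK4 G) :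
    ¬ AlgebraicIndependent K (fun p : E G => mf K p.1.1 p.1.2) := by
  intro hI
  obtain ⟨a, b, c, d, ab, ac, ad, bc, bd, cd⟩ := hK
  have hcl : G.IsNClique 4 {a, b, c, d} := by
    refine ⟨?_, ?_⟩
    · simp [SimpleGraph.isClique_iff, Set.pairwise_insert, ab, ac, ad, bc, bd, cd, ab.symm,
        ac.symm, ad.symm, bc.symm, bd.symm, cd.symm]
    · simp [ab.ne, ac.ne, ad.ne, bc.ne, bd.ne, cd.ne]
  let e := Finset.orderEmbOfFin _ hcl.card_eq
  have adj : ∀ u v : Fin 4, u < v → e u < e v ∧ G.Adj (e u) (e v) := fun u v huv =>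
    ⟨e.strictMono huv, hcl.isClique (Finset.orderEmbOfFin_mem _ _ u)
      (Finset.orderEmbOfFin_mem _ _ v) (e.strictMono huv).ne⟩
  let ed : ∀ u v : Fin 4, u < v → E G := fun u v huv => ⟨(e u, e v), adj u v huv⟩
  have edi : ∀ u v h u' v' h', ed u v h = ed u' v' h' ↔ (u = u' ∧ v = v') := by
    intro u v h u' v' h'
    simp [ed]
  let P : MvPolynomial (E G) K :=
    X (ed 0 1 (by decide)) * X (ed 2 3 (by decide)) - X (ed 0 2 (by decide)) * X (ed 1 3 (by decide))
      + X (ed 0 3 (by decide)) * X (ed 1 2 (by decide))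
  have hP : P = 0 := by
    apply (injective_iff_map_eq_zero _).mp hI
    simp only [P, map_add, map_sub, map_mul, aeval_X, ed, mf]
    ring
  classical
  have h2 := congrArg (MvPolynomial.eval
    (fun q : E G => if q = ed 0 1 (by decide) ∨ q = ed 2 3 (by decide) then (1 : K) else 0)) hP
  simp [P, edi] at h2

theorem adjoin_edge {n : ℕ} (G : SimpleGraph (Fin n)) :
    IntermediateField.adjoin K (edgeBinoms K G) =
      IntermediateField.adjoin K (Set.range (fun p : E G => mf K p.1.1 p.1.2)) := by
  apply le_antisymm
  · rw [IntermediateField.adjoin_le_iff]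
    rintro z ⟨i, j, hij, rfl⟩
    rw [← mf_eq]
    rcases lt_or_gt_of_ne hij.ne with h | h
    · exact IntermediateField.subset_adjoin K _ ⟨⟨(i, j), h, hij⟩, rfl⟩
    · rw [mf_swap]
      exact neg_mem (IntermediateField.subset_adjoin K _ ⟨⟨(j, i), h, hij.symm⟩, rfl⟩)
  · rw [IntermediateField.adjoin_le_iff]
    rintro _ ⟨p, rfl⟩
    exact IntermediateField.subset_adjoin K _ ⟨p.1.1, p.1.2, p.2.2, mf_eq K _ _⟩

theorem gen_lemma {L ι : Type} [Field L] [Algebra K L] [Finite ι] (f : ι → L) :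
    Algebra.trdeg K (IntermediateField.adjoin K (Set.range f)) ≤ #ι ∧
    (Algebra.trdeg K (IntermediateField.adjoin K (Set.range f)) = #ι ↔
      AlgebraicIndependent K f) := by
  let F := IntermediateField.adjoin K (Set.range f)
  let x : ι → F := fun i => ⟨f i, IntermediateField.subset_adjoin K _ ⟨i, rfl⟩⟩
  have hx : (F.val : F → L) ∘ x = f := rfl
  have htop : IntermediateField.adjoin K (Set.range x) = ⊤ := by
    apply IntermediateField.map_injective F.val
    rw [IntermediateField.adjoin_map, ← Set.range_comp, hx, ← AlgHom.fieldRange_eq_map,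
      IntermediateField.fieldRange_val]
  have halg := alg_of_adjoin_eq_top x htop
  have hiff : AlgebraicIndependent K f ↔ AlgebraicIndependent K x := by
    rw [← hx]
    exact F.val.algebraicIndependent_iff F.val.injective
  refine ⟨(Algebra.IsAlgebraic.trdeg_le_cardinalMk K (Set.range x)).trans mk_range_le, ?_, ?_⟩
  · intro h
    exact hiff.mpr (Algebra.IsAlgebraic.isTranscendenceBasis_of_le_trdeg_of_finite K x h.ge).1
  · intro h
    exact ((hiff.mp h).isTranscendenceBasis_iff_isAlgebraic.mpr halg).cardinalMk_eq_trdeg.symm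

end SpreadProof

/-- For a closed graph `G`, the analytic spread of `J_G` is at most the number of edges,
with equality if and only if `G` has no induced `K₄`. -/
theorem spread_closed_le_card_edges_iff_K4_free
    (K : Type) [Field K] [Infinite K] (n : ℕ) (G : SimpleGraph (Fin n))
    (hclosed : IsClosedGraph G) :
    spread K G ≤ (G.edgeSet.ncard : Cardinal) ∧
      (spread K G = (G.edgeSet.ncard : Cardinal) ↔ ¬ HasInducedK4 G) := by

  have h := SpreadProof.gen_lemma K
    (fun p : SpreadProof.E G => SpreadProof.mf K p.1.1 p.1.2)
  rw [← SpreadProof.adjoin_edge, SpreadProof.card_E] at h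
  refine ⟨h.1, h.2.trans ⟨fun hI hK => SpreadProof.not_indep_of_K4 K G hK hI,
    fun hK => SpreadProof.indep_of_K4_free K G hclosed hK⟩⟩
end
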